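/- Suppose x̲ < x ≤ x̄ and x ≤ x_c. Then v(x) = v2(x), and the strategy α*(t) := M(t) for all t ∈ [0,T] attains the infimum defining v(x). -/

import Mathlib

open MeasureTheory Set

noncomputable section

/-- Admissible repayment strategies: measurable, with `m t ≤ α t ≤ M t` on `[0,T]`. -/
def Adm (T : ℝ) (m M : ℝ → ℝ) : Set (ℝ → ℝ) :=
  {α | Measurable α ∧ ∀ t ∈ Icc (0:ℝ) T, m t ≤ α t ∧ α t ≤ M t}

/-- Compound-interest balance. -/
def balC (r β x : ℝ) (α : ℝ → ℝ) (t : ℝ) : ℝ :=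
  Real.exp ((r + β) * t) * (x - ∫ s in (0:ℝ)..t, Real.exp (-(r + β) * s) * α s)

/-- Terminal time: first zero of the balance in `[0,T]`, capped at `T`. -/
def tauC (r β T x : ℝ) (α : ℝ → ℝ) : ℝ :=
  sInf (insert T {t | t ∈ Icc (0:ℝ) T ∧ balC r β x α t = 0})

/-- Repayment cost. -/
def costC (r β T ω x : ℝ) (α : ℝ → ℝ) : ℝ :=
  (∫ t in (0:ℝ)..(tauC r β T x α), Real.exp (-r * t) * α t)
    + ω * Real.exp (-r * tauC r β T x α) * balC r β x α (tauC r β T x α)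

/-- Value function. -/
def valC (r β T ω : ℝ) (m M : ℝ → ℝ) (x : ℝ) : ℝ :=
  sInf (costC r β T ω x '' Adm T m M)

/-- Critical horizon `t_c = max(T + log ω / β, 0)`. -/
def tCrit (β T ω : ℝ) : ℝ := max (T + Real.log ω / β) 0

/-- The cost `v₁` of the max-min strategy. -/
def vOne (r β T ω : ℝ) (m M : ℝ → ℝ) (x : ℝ) : ℝ :=
  (∫ s in (0:ℝ)..(tCrit β T ω), Real.exp (-r * s) * M s)
  + (∫ s in (tCrit β T ω)..T, Real.exp (-r * s) * m s)
  + ω * Real.exp (β * T) *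
    (x - (∫ s in (0:ℝ)..(tCrit β T ω), Real.exp (-(r + β) * s) * M s)
       - ∫ s in (tCrit β T ω)..T, Real.exp (-(r + β) * s) * m s)

/-- `x̂ = ∫_0^{t_c} e^{-(r+β)s} M(s) ds`. -/
def xHat (r β T ω : ℝ) (M : ℝ → ℝ) : ℝ :=
  ∫ s in (0:ℝ)..(tCrit β T ω), Real.exp (-(r + β) * s) * M s

/-- `x̄ = ∫_0^T e^{-(r+β)s} M(s) ds`. -/
def xBar (r β T : ℝ) (M : ℝ → ℝ) : ℝ :=
  ∫ s in (0:ℝ)..T, Real.exp (-(r + β) * s) * M s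

/-- `x̲ = ∫_0^T e^{-(r+β)s} m(s) ds`. -/
def xLow (r β T : ℝ) (m : ℝ → ℝ) : ℝ :=
  ∫ s in (0:ℝ)..T, Real.exp (-(r + β) * s) * m s

/-- `x_c = ∫_0^{t_c} e^{-(r+β)s} M(s) ds + ∫_{t_c}^T e^{-(r+β)s} m(s) ds`. -/
def xCrit (r β T ω : ℝ) (m M : ℝ → ℝ) : ℝ :=
  xHat r β T ω M + ∫ s in (tCrit β T ω)..T, Real.exp (-(r + β) * s) * m s

/-- Exchange inequality: if `q ≤ p` before `θ` and `p ≤ q` after `θ`, moving mass from `p` to `q`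
costs at least `exp (β * θ)` per unit of discounted mass. -/
lemma exchange_le (r β T θ : ℝ) (hβ : 0 ≤ β) (hT : 0 ≤ T) (p q : ℝ → ℝ)
    (hp : IntervalIntegrable p volume 0 T) (hq : IntervalIntegrable q volume 0 T)
    (h1 : ∀ t ∈ Ioo (0:ℝ) T, t ≤ θ → q t ≤ p t)
    (h2 : ∀ t ∈ Ioo (0:ℝ) T, θ < t → p t ≤ q t) :
    (∫ t in (0:ℝ)..T, Real.exp (-r * t) * p t)
      + Real.exp (β * θ) * ((∫ t in (0:ℝ)..T, Real.exp (-(r + β) * t) * q t)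
        - ∫ t in (0:ℝ)..T, Real.exp (-(r + β) * t) * p t)
      ≤ ∫ t in (0:ℝ)..T, Real.exp (-r * t) * q t := by
  have hw : ∀ (c : ℝ) (f : ℝ → ℝ), IntervalIntegrable f volume 0 T →
      IntervalIntegrable (fun t => Real.exp (c * t) * f t) volume 0 T := fun c f hf =>
    hf.continuousOn_mul (by fun_prop)
  rw [← intervalIntegral.integral_sub (hw _ _ hq) (hw _ _ hp),
    ← intervalIntegral.integral_const_mul,
    ← intervalIntegral.integral_add (hw _ _ hp) (((hw _ _ hq).sub (hw _ _ hp)).const_mul _)]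
  refine intervalIntegral.integral_mono_on_of_le_Ioo hT
    ((hw _ _ hp).add (((hw _ _ hq).sub (hw _ _ hp)).const_mul _)) (hw _ _ hq) fun t ht => ?_
  have he : Real.exp (-r * t) = Real.exp (β * t) * Real.exp (-(r + β) * t) := by
    rw [← Real.exp_add]; ring_nf
  have hprod : 0 ≤ (Real.exp (β * t) - Real.exp (β * θ)) * (q t - p t) := by
    rcases le_or_gt t θ with h | h
    · exact mul_nonneg_of_nonpos_of_nonpos
        (sub_nonpos.2 (Real.exp_le_exp.2 (mul_le_mul_of_nonneg_left h hβ)))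
        (sub_nonpos.2 (h1 t ht h))
    · exact mul_nonneg
        (sub_nonneg.2 (Real.exp_le_exp.2 (mul_le_mul_of_nonneg_left h.le hβ)))
        (sub_nonneg.2 (h2 t ht h))
  have := mul_nonneg (Real.exp_pos (-(r + β) * t)).le hprod
  rw [he]
  linarith

lemma continuousOn_balC (r β T x : ℝ) (hT : 0 ≤ T) (α : ℝ → ℝ)
    (hα : IntervalIntegrable α volume 0 T) : ContinuousOn (balC r β x α) (Icc 0 T) := by
  have hw : IntegrableOn (fun t => Real.exp (-(r + β) * t) * α t) (uIcc 0 T) :=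
    (intervalIntegrable_iff' enorm_ne_top).1 (hα.continuousOn_mul (by fun_prop))
  have hc := intervalIntegral.continuousOn_primitive_interval hw
  rw [uIcc_of_le hT] at hc
  unfold balC
  exact ContinuousOn.mul (by fun_prop) (continuousOn_const.sub hc)

lemma tauC_spec (r β T x : ℝ) (hT : 0 ≤ T) (hx : 0 ≤ x) (α : ℝ → ℝ)
    (hα : IntervalIntegrable α volume 0 T) :
    tauC r β T x α ∈ Icc 0 T ∧
      (balC r β x α (tauC r β T x α) = 0 ∨
        tauC r β T x α = T ∧ 0 ≤ balC r β x α T) := by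
  have hc := continuousOn_balC r β T x hT α hα
  set S : Set ℝ := insert T {t | t ∈ Icc (0:ℝ) T ∧ balC r β x α t = 0} with hS
  have hbdd : BddBelow S := ⟨0, by
    rintro t (rfl | ht)
    · exact hT
    · exact ht.1.1⟩
  have hclosed : IsClosed S := by
    rw [hS, insert_eq]
    exact isClosed_singleton.union (hc.preimage_isClosed_of_isClosed isClosed_Icc isClosed_singleton)
  have hmem : tauC r β T x α ∈ S := hclosed.csInf_mem (insert_nonempty _ _) hbdd
  rcases hmem with h | h
  · rw [h]
    refine ⟨right_mem_Icc.2 hT, or_iff_not_imp_left.2 fun hne => ⟨rfl, ?_⟩⟩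
    by_contra! hneg
    have h0 : 0 ≤ balC r β x α 0 := by simpa [balC] using hx
    obtain ⟨t, ht, hzero⟩ := intermediate_value_Icc' hT hc ⟨hneg.le, h0⟩
    have hle : tauC r β T x α ≤ t := csInf_le hbdd (mem_insert_of_mem _ ⟨ht, hzero⟩)
    rw [h] at hle
    exact hne (le_antisymm ht.2 hle ▸ hzero)
  · exact ⟨h.1, Or.inl h.2⟩

lemma integral_mul_indicator_Iic (c T τ : ℝ) (hτ : τ ∈ Icc 0 T) (f : ℝ → ℝ) :
    ∫ t in (0:ℝ)..T, Real.exp (c * t) * (Iic τ).indicator f t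
      = ∫ t in (0:ℝ)..τ, Real.exp (c * t) * f t := by
  rw [← intervalIntegral.integral_indicator hτ]
  congr 1 with t
  exact (indicator_mul_right (Iic τ) (fun t => Real.exp (c * t)) f).symm

lemma intervalIntegrable_indicator_Iic (T τ : ℝ) (f : ℝ → ℝ)
    (hf : IntervalIntegrable f volume 0 T) :
    IntervalIntegrable ((Iic τ).indicator f) volume 0 T :=
  ⟨hf.1.indicator measurableSet_Iic, hf.2.indicator measurableSet_Iic⟩

lemma balC_eq_zero_iff (r β x : ℝ) (α : ℝ → ℝ) (t : ℝ) :
    balC r β x α t = 0 ↔ x = ∫ s in (0:ℝ)..t, Real.exp (-(r + β) * s) * α s := by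
  simp [balC, (Real.exp_pos _).ne', sub_eq_zero]

lemma exp_mul_balC (r β x : ℝ) (α : ℝ → ℝ) (t : ℝ) :
    Real.exp (-r * t) * balC r β x α t
      = Real.exp (β * t) * (x - ∫ s in (0:ℝ)..t, Real.exp (-(r + β) * s) * α s) := by
  rw [balC, ← mul_assoc, ← Real.exp_add]
  ring_nf

lemma Adm.intervalIntegrable {T : ℝ} {m M α : ℝ → ℝ} (hT : 0 ≤ T)
    (hm : ∀ t ∈ Icc (0:ℝ) T, 0 ≤ m t) (hM : IntervalIntegrable M volume 0 T)
    (hα : α ∈ Adm T m M) : IntervalIntegrable α volume 0 T := by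
  refine hM.mono_fun hα.1.aestronglyMeasurable ?_
  refine (ae_restrict_iff' measurableSet_uIoc).2 (ae_of_all _ fun t ht => ?_)
  rw [uIoc_of_le hT] at ht
  have h := hα.2 t ⟨ht.1.le, ht.2⟩
  have h0 := hm t ⟨ht.1.le, ht.2⟩
  simp only [Real.norm_of_nonneg (h0.trans h.1), Real.norm_of_nonneg (h0.trans (h.1.trans h.2))]
  exact h.2

/-- Every strategy bounded by `0` and `M` costs at least as much as paying at rate `M` up to `tM`,
corrected by the difference of discounted masses at the price `exp (β * tM)`. -/
lemma max_strategy_le (r β T tM : ℝ) (hβ : 0 ≤ β) (htM : tM ∈ Icc 0 T) (M q : ℝ → ℝ)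
    (hM : IntervalIntegrable M volume 0 T) (hq : IntervalIntegrable q volume 0 T)
    (h : ∀ t ∈ Ioo (0:ℝ) T, 0 ≤ q t ∧ q t ≤ M t) :
    (∫ t in (0:ℝ)..tM, Real.exp (-r * t) * M t)
      + Real.exp (β * tM) * ((∫ t in (0:ℝ)..T, Real.exp (-(r + β) * t) * q t)
        - ∫ t in (0:ℝ)..tM, Real.exp (-(r + β) * t) * M t)
      ≤ ∫ t in (0:ℝ)..T, Real.exp (-r * t) * q t := by
  have key := exchange_le r β T tM hβ (htM.1.trans htM.2) ((Iic tM).indicator M) q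
    (intervalIntegrable_indicator_Iic _ _ _ hM) hq
    (fun t ht hle => by simpa [indicator, hle] using (h t ht).2)
    (fun t ht hlt => by simpa [indicator, not_le.2 hlt] using (h t ht).1)
  rwa [integral_mul_indicator_Iic _ _ _ htM, integral_mul_indicator_Iic _ _ _ htM] at key

lemma integral_mul_ite_le (c T τ : ℝ) (hτ : τ ∈ Icc 0 T) (f g : ℝ → ℝ)
    (hf : IntervalIntegrable f volume 0 T) (hg : IntervalIntegrable g volume 0 T) :
    ∫ t in (0:ℝ)..T, Real.exp (c * t) * (if t ≤ τ then f t else g t)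
      = (∫ t in (0:ℝ)..τ, Real.exp (c * t) * f t) + ∫ t in τ..T, Real.exp (c * t) * g t := by
  have hT := hτ.1.trans hτ.2
  have hw : ∀ f : ℝ → ℝ, IntervalIntegrable f volume 0 T →
      IntervalIntegrable (fun t => Real.exp (c * t) * f t) volume 0 T := fun f hf =>
    hf.continuousOn_mul (by fun_prop)
  have hmem : τ ∈ uIcc 0 T := by rwa [uIcc_of_le hT]
  have hsplit : (fun t => Real.exp (c * t) * (if t ≤ τ then f t else g t))
      = fun t => Real.exp (c * t) * (Iic τ).indicator (f - g) t + Real.exp (c * t) * g t := by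
    ext t
    by_cases h : t ≤ τ <;> simp [indicator, h]; ring
  have hsub : IntervalIntegrable g volume 0 τ :=
    hg.mono_set (uIcc_subset_uIcc_left hmem)
  have hsubf : IntervalIntegrable f volume 0 τ :=
    hf.mono_set (uIcc_subset_uIcc_left hmem)
  have hsub' : IntervalIntegrable g volume τ T :=
    hg.mono_set (uIcc_subset_uIcc_right hmem)
  rw [hsplit, intervalIntegral.integral_add
    (hw _ (intervalIntegrable_indicator_Iic _ _ (f - g) (hf.sub hg))) (hw _ hg),
    integral_mul_indicator_Iic _ _ _ hτ,
    ← intervalIntegral.integral_add_adjacent_intervals (b := τ)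
      (hsub.continuousOn_mul (by fun_prop)) (hsub'.continuousOn_mul (by fun_prop))]
  simp only [Pi.sub_apply, mul_sub]
  rw [intervalIntegral.integral_sub (hsubf.continuousOn_mul (by fun_prop))
    (hsub.continuousOn_mul (by fun_prop))]
  ring


/-- for `x̲ < x ≤ x̄` with `x ≤ x_c`, `v(x) = v₂(x)` and the max
strategy attains the infimum defining `v(x)`. -/
theorem stmt7 (r β T ω : ℝ) (m M : ℝ → ℝ)
    (hr : 0 < r) (hβ : 0 < β) (hT : 0 < T) (hω : ω ∈ Ioo (0:ℝ) 1)
    (hmMeas : Measurable m) (hMMeas : Measurable M)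
    (hmInt : IntegrableOn m (Icc (0:ℝ) T)) (hMInt : IntegrableOn M (Icc (0:ℝ) T))
    (hmM : ∀ t ∈ Icc (0:ℝ) T, 0 < m t ∧ m t < M t)
    (x : ℝ) (hx1 : xLow r β T m < x) (hx2 : x ≤ xBar r β T M)
    (hx3 : x ≤ xCrit r β T ω m M)
    (tM : ℝ) (htM : tM ∈ Ioc (0:ℝ) T)
    (htMEq : x = ∫ s in (0:ℝ)..tM, Real.exp (-(r + β) * s) * M s)
    (htMuniq : ∀ t' ∈ Ioc (0:ℝ) T,
      x = (∫ s in (0:ℝ)..t', Real.exp (-(r + β) * s) * M s) → t' = tM) :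
    valC r β T ω m M x = (∫ s in (0:ℝ)..tM, Real.exp (-r * s) * M s) ∧
    M ∈ Adm T m M ∧
    costC r β T ω x M = valC r β T ω m M x := by
  have hM : IntervalIntegrable M volume 0 T :=
    (intervalIntegrable_iff_integrableOn_Icc_of_le hT.le).2 hMInt
  have hm : IntervalIntegrable m volume 0 T :=
    (intervalIntegrable_iff_integrableOn_Icc_of_le hT.le).2 hmInt
  have hxpos : 0 < x := lt_of_le_of_lt (intervalIntegral.integral_nonneg hT.le fun t ht =>
    mul_nonneg (Real.exp_pos _).le (hmM t ht).1.le) hx1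
  have hMAdm : M ∈ Adm T m M := ⟨hMMeas, fun t ht => ⟨(hmM t ht).2.le, le_rfl⟩⟩
  have htM' : tM ∈ Icc 0 T := Ioc_subset_Icc_self htM
  have hzeros : {t | t ∈ Icc (0:ℝ) T ∧ balC r β x M t = 0} = {tM} := by
    ext t
    simp only [mem_ofPred_eq, mem_singleton_iff, balC_eq_zero_iff]
    constructor
    · rintro ⟨ht, h⟩
      rcases ht.1.eq_or_lt with rfl | h0
      · simp at h
        exact absurd h hxpos.ne'
      · exact htMuniq t ⟨h0, ht.2⟩ h
    · rintro rfl
      exact ⟨htM', htMEq⟩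
  have htau : tauC r β T x M = tM := by
    rw [tauC, hzeros, csInf_pair]
    exact inf_eq_right.2 htM.2
  have hcost : costC r β T ω x M = ∫ s in (0:ℝ)..tM, Real.exp (-r * s) * M s := by
    rw [costC, htau, (balC_eq_zero_iff r β x M tM).2 htMEq, mul_zero, add_zero]
  have hlower : ∀ α ∈ Adm T m M,
      (∫ s in (0:ℝ)..tM, Real.exp (-r * s) * M s) ≤ costC r β T ω x α := by
    intro α hα
    have hαI := Adm.intervalIntegrable hT.le (fun t ht => (hmM t ht).1.le) hM hα
    have hα0 : ∀ t ∈ Ioo (0:ℝ) T, 0 ≤ α t ∧ α t ≤ M t := fun t ht =>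
      have ht' := Ioo_subset_Icc_self ht
      ⟨(hmM t ht').1.le.trans (hα.2 t ht').1, (hα.2 t ht').2⟩
    obtain ⟨hτ, h | ⟨hτT, hbal⟩⟩ := tauC_spec r β T x hT.le hxpos.le α hαI
    · rw [costC, h, mul_zero, add_zero]
      have key := max_strategy_le r β T tM hβ.le htM' M
        ((Iic (tauC r β T x α)).indicator α) hM
        (intervalIntegrable_indicator_Iic _ _ _ hαI) fun t ht => by
          by_cases hle : t ≤ tauC r β T x α
          · simpa [indicator, hle] using hα0 t ht
          · simpa [indicator, hle] using (hα0 t ht).1.trans (hα0 t ht).2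
      rw [integral_mul_indicator_Iic _ _ _ hτ, integral_mul_indicator_Iic _ _ _ hτ,
        ← (balC_eq_zero_iff r β x α _).1 h, ← htMEq] at key
      simpa using key
    · have hrem : 0 ≤ x - ∫ s in (0:ℝ)..T, Real.exp (-(r + β) * s) * α s :=
        nonneg_of_mul_nonneg_right hbal (Real.exp_pos _)
      set θ := T + Real.log ω / β with hθ
      have hexp : ω * Real.exp (β * T) = Real.exp (β * θ) := by
        rw [hθ, mul_add, mul_div_cancel₀ _ hβ.ne', Real.exp_add, Real.exp_log hω.1, mul_comm]
      have hθT : θ ≤ T := by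
        have := div_nonpos_of_nonpos_of_nonneg (Real.log_nonpos hω.1.le hω.2.le) hβ.le
        linarith
      rw [costC, hτT, mul_assoc, exp_mul_balC, ← mul_assoc, hexp]
      rcases lt_or_ge tM θ with hlt | hge
      · have key := max_strategy_le r β T tM hβ.le htM' M α hM hαI hα0
        rw [← htMEq] at key
        have := mul_le_mul_of_nonneg_right
          (Real.exp_le_exp.2 (mul_le_mul_of_nonneg_left hlt.le hβ.le)) hrem
        linarith
      · have hc : tCrit β T ω ∈ Icc 0 T := ⟨le_max_right _ _, max_le hθT hT.le⟩
        set p : ℝ → ℝ := fun t => if t ≤ tCrit β T ω then M t else m t with hp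
        have hpAdm : p ∈ Adm T m M := by
          refine ⟨hMMeas.ite measurableSet_Iic hmMeas, fun t ht => ?_⟩
          have := (hmM t ht).2.le
          by_cases h : t ≤ tCrit β T ω <;> simp [hp, h, this]
        have hpI := Adm.intervalIntegrable hT.le (fun t ht => (hmM t ht).1.le) hM hpAdm
        have hpmass : ∫ s in (0:ℝ)..T, Real.exp (-(r + β) * s) * p s = xCrit r β T ω m M :=
          integral_mul_ite_le _ _ _ hc _ _ hM hm
        have hex := exchange_le r β T θ hβ.le hT.le p α hpI hαI
          (fun t ht hle => by
            have hle' : t ≤ tCrit β T ω := hle.trans (le_max_left _ _)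
            simpa [hp, hle'] using (hα0 t ht).2)
          (fun t ht hlt => by
            have hgt : ¬ t ≤ tCrit β T ω := not_le.2 (max_lt hlt ht.1)
            simpa [hp, hgt] using (hα.2 t (Ioo_subset_Icc_self ht)).1)
        have key := max_strategy_le r β T tM hβ.le htM' M p hM hpI fun t ht =>
          have ht' := Ioo_subset_Icc_self ht
          ⟨(hmM t ht').1.le.trans (hpAdm.2 t ht').1, (hpAdm.2 t ht').2⟩
        rw [← htMEq, hpmass] at key
        rw [hpmass] at hex
        have := mul_le_mul_of_nonneg_right
          (Real.exp_le_exp.2 (mul_le_mul_of_nonneg_left hge hβ.le)) (sub_nonneg.2 hx3)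
        linarith
  have hval : valC r β T ω m M x = ∫ s in (0:ℝ)..tM, Real.exp (-r * s) * M s :=
    IsLeast.csInf_eq ⟨⟨M, hMAdm, hcost⟩, forall_mem_image.2 hlower⟩
  exact ⟨hval, hMAdm, hcost.trans hval.symm⟩
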